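/- arXiv:1609.02303 — 6 statements merged into one kernel-verified Lean document; each statement's English description precedes it below -/
import Mathlib

section
/- Let n, i, w be integers with 1 ≤ w ≤ i ≤ n − i, let a ∈ ℂ[x,y], b, c ∈ ℂ[y] and d ∈ ℂ[y,z] be polynomials, and suppose that b(0) ≠ 0 or c(0) ≠ 0. Then the quotient of ℂ[x,y,z] by the ideal generated by x, y^i, c·y^w + d·z, y^{n−i}, z, a·x + b·y^w is a finite-dimensional ℂ-vector space of dimension w. -/
open MvPolynomial

theorem X_one_pow_mem_of_coeff_zero_ne_zero {I : Ideal (MvPolynomial (Fin 3) ℂ)} {i w : ℕ}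
    {b : Polynomial ℂ} (hb : b.coeff 0 ≠ 0) (hi : (X 1 : MvPolynomial (Fin 3) ℂ) ^ i ∈ I)
    (hbw : Polynomial.aeval (X 1 : MvPolynomial (Fin 3) ℂ) b * X 1 ^ w ∈ I) :
    (X 1 : MvPolynomial (Fin 3) ℂ) ^ w ∈ I := by
  have hcop : IsCoprime (Polynomial.X ^ i) b :=
    (Polynomial.irreducible_X.coprime_iff_not_dvd.2
      fun h => hb (Polynomial.X_dvd_iff.1 h)).pow_left
  obtain ⟨u, v, huv⟩ := hcop
  have h := congrArg (Polynomial.aeval (X 1 : MvPolynomial (Fin 3) ℂ)) huv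
  simp only [map_add, map_mul, map_pow, Polynomial.aeval_X, map_one] at h
  have key : (X 1 : MvPolynomial (Fin 3) ℂ) ^ w =
      (X 1 ^ w * Polynomial.aeval (X 1 : MvPolynomial (Fin 3) ℂ) u) * X 1 ^ i +
      Polynomial.aeval (X 1 : MvPolynomial (Fin 3) ℂ) v *
        (Polynomial.aeval (X 1 : MvPolynomial (Fin 3) ℂ) b * X 1 ^ w) := by
    linear_combination -(X 1 : MvPolynomial (Fin 3) ℂ) ^ w * h
  rw [key]
  exact I.add_mem (I.mul_mem_left _ hi) (I.mul_mem_left _ hbw)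

/-- Restriction of polynomials to the `y`-axis. -/
noncomputable def restrictAxis : MvPolynomial (Fin 3) ℂ →ₐ[ℂ] Polynomial ℂ :=
  aeval ![0, Polynomial.X, 0]

theorem sub_aeval_restrictAxis_mem {J : Ideal (MvPolynomial (Fin 3) ℂ)}
    (h0 : X 0 ∈ J) (h2 : X 2 ∈ J) (p : MvPolynomial (Fin 3) ℂ) :
    p - Polynomial.aeval (X 1) (restrictAxis p) ∈ J := by
  have h : Ideal.Quotient.mkₐ ℂ J =
      (Ideal.Quotient.mkₐ ℂ J).comp ((Polynomial.aeval (X 1)).comp restrictAxis) := by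
    refine MvPolynomial.algHom_ext fun k => ?_
    fin_cases k
    · simpa [restrictAxis] using Ideal.Quotient.eq_zero_iff_mem.2 h0
    · simp [restrictAxis]
    · simpa [restrictAxis] using Ideal.Quotient.eq_zero_iff_mem.2 h2
  exact Ideal.Quotient.eq.1 (DFunLike.congr_fun h p)

theorem ker_mk_comp_restrictAxis (w : ℕ) :
    RingHom.ker ((Ideal.Quotient.mkₐ ℂ (Ideal.span {(Polynomial.X : Polynomial ℂ) ^ w})).comp
      restrictAxis) = Ideal.span {(X 0 : MvPolynomial (Fin 3) ℂ), X 1 ^ w, X 2} := by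
  apply le_antisymm
  · intro p hp
    have hp' : restrictAxis p ∈ Ideal.span {(Polynomial.X : Polynomial ℂ) ^ w} :=
      Ideal.Quotient.eq_zero_iff_mem.1 hp
    obtain ⟨q, hq⟩ := Ideal.mem_span_singleton.1 hp'
    have h := sub_aeval_restrictAxis_mem
      (J := Ideal.span {(X 0 : MvPolynomial (Fin 3) ℂ), X 1 ^ w, X 2})
      (Ideal.subset_span (by simp)) (Ideal.subset_span (by simp)) p
    refine (Submodule.sub_mem_iff_left _ ?_).1 h
    rw [hq, map_mul, map_pow, Polynomial.aeval_X]
    exact Ideal.mul_mem_right _ _ (Ideal.subset_span (by simp))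
  · rw [Ideal.span_le]
    rintro p (rfl | rfl | rfl)
    · simp [restrictAxis]
    · refine Ideal.Quotient.eq_zero_iff_mem.2 (Ideal.mem_span_singleton.2 ?_)
      simp [restrictAxis]
    · simp [restrictAxis]

theorem restrictAxis_surjective : Function.Surjective restrictAxis := fun p =>
  ⟨Polynomial.aeval (X 1) p, by
    rw [← Polynomial.aeval_algHom_apply]
    simp [restrictAxis]⟩

theorem finite_and_finrank_quotient_span_X_pow (w : ℕ) :
    FiniteDimensional ℂ (MvPolynomial (Fin 3) ℂ ⧸
      Ideal.span {(X 0 : MvPolynomial (Fin 3) ℂ), X 1 ^ w, X 2}) ∧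
    Module.finrank ℂ (MvPolynomial (Fin 3) ℂ ⧸
      Ideal.span {(X 0 : MvPolynomial (Fin 3) ℂ), X 1 ^ w, X 2}) = w := by
  rw [← ker_mk_comp_restrictAxis]
  have hs : Function.Surjective ((Ideal.Quotient.mkₐ ℂ
      (Ideal.span {(Polynomial.X : Polynomial ℂ) ^ w})).comp restrictAxis) :=
    (Ideal.Quotient.mkₐ_surjective ℂ _).comp restrictAxis_surjective
  have e := (Ideal.quotientKerAlgEquivOfSurjective hs).toLinearEquiv
  have hfin : Module.Finite ℂ
      (Polynomial ℂ ⧸ Ideal.span {(Polynomial.X : Polynomial ℂ) ^ w}) :=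
    (Polynomial.monic_X_pow w).finite_quotient
  refine ⟨Module.Finite.equiv e.symm, ?_⟩
  rw [e.finrank_eq, finrank_quotient_span_eq_natDegree, Polynomial.natDegree_X_pow]

/-- Width of the unprojection divisor in the type Aⁱ_{n−1} case: if b₀ ≠ 0 or
c₀ ≠ 0 then dim_ℂ ℂ[x,y,z]/(x, yⁱ, c·y^w + d·z, y^{n−i}, z, a·x + b·y^w) = w. -/
theorem stmt_8 (n i w : ℕ) (h1 : 1 ≤ w) (h2 : w ≤ i) (h3 : i ≤ n - i)
    (a : MvPolynomial (Fin 2) ℂ) (b c : Polynomial ℂ) (d : MvPolynomial (Fin 2) ℂ)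
    (hbc : Polynomial.coeff b 0 ≠ 0 ∨ Polynomial.coeff c 0 ≠ 0)
    (a' : MvPolynomial (Fin 3) ℂ)
    (ha' : a' = MvPolynomial.aeval ![(X 0 : MvPolynomial (Fin 3) ℂ), X 1] a)
    (b' : MvPolynomial (Fin 3) ℂ)
    (hb' : b' = Polynomial.aeval (X 1 : MvPolynomial (Fin 3) ℂ) b)
    (c' : MvPolynomial (Fin 3) ℂ)
    (hc' : c' = Polynomial.aeval (X 1 : MvPolynomial (Fin 3) ℂ) c)
    (d' : MvPolynomial (Fin 3) ℂ)
    (hd' : d' = MvPolynomial.aeval ![(X 1 : MvPolynomial (Fin 3) ℂ), X 2] d) :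
    FiniteDimensional ℂ
      (MvPolynomial (Fin 3) ℂ ⧸
        Ideal.span {(X 0 : MvPolynomial (Fin 3) ℂ), (X 1) ^ i,
          c' * (X 1) ^ w + d' * X 2, (X 1) ^ (n - i), X 2, a' * X 0 + b' * (X 1) ^ w}) ∧
    Module.finrank ℂ
      (MvPolynomial (Fin 3) ℂ ⧸
        Ideal.span {(X 0 : MvPolynomial (Fin 3) ℂ), (X 1) ^ i,
          c' * (X 1) ^ w + d' * X 2, (X 1) ^ (n - i), X 2, a' * X 0 + b' * (X 1) ^ w}) =
      w := by
  have hspan : Ideal.span {(X 0 : MvPolynomial (Fin 3) ℂ), (X 1) ^ i,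
      c' * (X 1) ^ w + d' * X 2, (X 1) ^ (n - i), X 2, a' * X 0 + b' * (X 1) ^ w} =
      Ideal.span {(X 0 : MvPolynomial (Fin 3) ℂ), X 1 ^ w, X 2} := by
    apply le_antisymm
    · set J := Ideal.span {(X 0 : MvPolynomial (Fin 3) ℂ), X 1 ^ w, X 2}
      have hx : X 0 ∈ J := Ideal.subset_span (by simp)
      have hy : X 1 ^ w ∈ J := Ideal.subset_span (by simp)
      have hz : X 2 ∈ J := Ideal.subset_span (by simp)
      rw [Ideal.span_le]
      rintro p (rfl | rfl | rfl | rfl | rfl | rfl)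
      · exact hx
      · exact J.mem_of_dvd (pow_dvd_pow _ h2) hy
      · exact J.add_mem (J.mul_mem_left _ hy) (J.mul_mem_left _ hz)
      · exact J.mem_of_dvd (pow_dvd_pow _ (h2.trans h3)) hy
      · exact hz
      · exact J.add_mem (J.mul_mem_left _ hx) (J.mul_mem_left _ hy)
    · set I := Ideal.span {(X 0 : MvPolynomial (Fin 3) ℂ), (X 1) ^ i,
        c' * (X 1) ^ w + d' * X 2, (X 1) ^ (n - i), X 2, a' * X 0 + b' * (X 1) ^ w}
      have hx : X 0 ∈ I := Ideal.subset_span (by simp)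
      have hy : X 1 ^ i ∈ I := Ideal.subset_span (by simp)
      have hz : X 2 ∈ I := Ideal.subset_span (by simp)
      have hc : c' * X 1 ^ w + d' * X 2 ∈ I := Ideal.subset_span (by simp)
      have hb : a' * X 0 + b' * X 1 ^ w ∈ I := Ideal.subset_span (by simp)
      rw [Ideal.span_le]
      rintro p (rfl | rfl | rfl)
      · exact hx
      · rcases hbc with h | h
        · refine X_one_pow_mem_of_coeff_zero_ne_zero h hy ?_
          rw [← hb']
          exact (Submodule.add_mem_iff_right _ (I.mul_mem_left _ hx)).1 hb
        · refine X_one_pow_mem_of_coeff_zero_ne_zero h hy ?_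
          rw [← hc']
          exact (Submodule.add_mem_iff_left _ (I.mul_mem_left _ hz)).1 hc
      · exact hz
  rw [hspan]
  exact finite_and_finrank_quotient_span_X_pow w
end

section
/- Let R be a commutative ring, let x, y, z, a, b ∈ R, and let n, i be integers with i ≥ 1 and n ≥ 2i. Set Δ₁ = x·z − y^n, Δ₂ = a·x + b·y^{n−i}, Δ₃ = a·y^i + b·z, and ζ = a²·x + 2·a·b·y^{n−i} + b²·y^{n−2i}·z. Then the following three identities hold in R: (1) x·ζ = Δ₂² + b²·y^{n−2i}·Δ₁; (2) y^i·ζ = Δ₂·Δ₃ − a·b·Δ₁; (3) z·ζ = y^{n−2i}·Δ₃² + a²·Δ₁. In particular, ζ multiplied by any element of the ideal (x, y^i, z) lies in I² + (Δ₁), where I is the ideal (Δ₁, Δ₂, Δ₃). -/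
/-- The unprojection variable ζ in the type Aⁱ_{n−1} case: explicit identities
showing ζ·(x, yⁱ, z) ⊆ I² + (Δ₁). -/
theorem stmt_9 (R : Type*) [CommRing R] (x y z a b : R) (n i : ℕ)
    (hi : 1 ≤ i) (hn : 2 * i ≤ n)
    (Δ₁ Δ₂ Δ₃ ζ : R)
    (hΔ₁ : Δ₁ = x * z - y ^ n)
    (hΔ₂ : Δ₂ = a * x + b * y ^ (n - i))
    (hΔ₃ : Δ₃ = a * y ^ i + b * z)
    (hζ : ζ = a ^ 2 * x + 2 * a * b * y ^ (n - i) + b ^ 2 * y ^ (n - 2 * i) * z) :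
    (x * ζ = Δ₂ ^ 2 + b ^ 2 * y ^ (n - 2 * i) * Δ₁ ∧
     y ^ i * ζ = Δ₂ * Δ₃ - a * b * Δ₁ ∧
     z * ζ = y ^ (n - 2 * i) * Δ₃ ^ 2 + a ^ 2 * Δ₁) ∧
    ∀ t ∈ Ideal.span ({x, y ^ i, z} : Set R),
      ζ * t ∈ (Ideal.span ({Δ₁, Δ₂, Δ₃} : Set R)) ^ 2 + Ideal.span ({Δ₁} : Set R) := by
  have hyn : y ^ n = (y ^ i) ^ 2 * y ^ (n - 2 * i) := by
    rw [← pow_mul, ← pow_add]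
    congr 1
    omega
  have hyni : y ^ (n - i) = y ^ i * y ^ (n - 2 * i) := by
    rw [← pow_add]
    congr 1
    omega
  rw [hyn] at hΔ₁
  rw [hyni] at hΔ₂ hζ
  have hx : x * ζ = Δ₂ ^ 2 + b ^ 2 * y ^ (n - 2 * i) * Δ₁ := by
    rw [hΔ₁, hΔ₂, hζ]
    ring
  have hy : y ^ i * ζ = Δ₂ * Δ₃ - a * b * Δ₁ := by
    rw [hΔ₁, hΔ₂, hΔ₃, hζ]
    ring
  have hz : z * ζ = y ^ (n - 2 * i) * Δ₃ ^ 2 + a ^ 2 * Δ₁ := by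
    rw [hΔ₁, hΔ₃, hζ]
    ring
  refine ⟨⟨hx, hy, hz⟩, fun t ht => ?_⟩
  have h₁ : Δ₁ ∈ Ideal.span ({Δ₁} : Set R) := Ideal.mem_span_singleton_self Δ₁
  have h₂ : Δ₂ ∈ Ideal.span ({Δ₁, Δ₂, Δ₃} : Set R) := Ideal.subset_span (by simp)
  have h₃ : Δ₃ ∈ Ideal.span ({Δ₁, Δ₂, Δ₃} : Set R) := Ideal.subset_span (by simp)
  induction ht using Submodule.span_induction with
  | mem t ht =>
    rw [mul_comm]
    rcases ht with rfl | rfl | rfl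
    · rw [hx]
      exact Submodule.add_mem_sup (Ideal.pow_mem_pow h₂ 2) (Ideal.mul_mem_left _ _ h₁)
    · rw [hy, sub_eq_add_neg, pow_two]
      exact Submodule.add_mem_sup (Ideal.mul_mem_mul h₂ h₃)
        (neg_mem (Ideal.mul_mem_left _ _ h₁))
    · rw [hz]
      exact Submodule.add_mem_sup (Ideal.mul_mem_left _ _ (Ideal.pow_mem_pow h₃ 2))
        (Ideal.mul_mem_left _ _ h₁)
  | zero => simp
  | add s t _ _ hs ht =>
    rw [mul_add]
    exact add_mem hs ht
  | smul r t _ ht =>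
    rw [smul_eq_mul, mul_left_comm]
    exact Ideal.mul_mem_left _ r ht
end

section
/- There is an isomorphism of ℂ-algebras ℂ[x,y,z]/(x² − x·y² + y·z²) ≅ ℂ[x,y,z]/(x² + y²·z + z⁴). -/
open MvPolynomial

theorem MvPolynomial.C_I_sq {σ : Type*} : (C Complex.I : MvPolynomial σ ℂ) ^ 2 = -1 := by
  rw [← C_pow, Complex.I_sq, C_neg, C_1]

theorem MvPolynomial.eight_mul_C_inv_eight {σ : Type*} :
    (8 : MvPolynomial σ ℂ) * C 8⁻¹ = 1 := by
  rw [← map_ofNat C 8, ← C_mul, mul_inv_cancel₀ (by norm_num), C_1]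

/-- The automorphism `x ↦ 8ix + 8z²`, `y ↦ -4z`, `z ↦ 4y` of `ℂ[x, y, z]`, which completes the
square in `x² - xy² + yz²` and turns it into `-64(x² + y²z + z⁴)`. -/
noncomputable def completeSquareEquiv :
    MvPolynomial (Fin 3) ℂ ≃ₐ[ℂ] MvPolynomial (Fin 3) ℂ :=
  AlgEquiv.ofAlgHom
    (aeval ![8 * C Complex.I * X 0 + 8 * X 2 ^ 2, -4 * X 2, 4 * X 1])
    (aeval ![-C Complex.I * C 8⁻¹ * (X 0 - 4 * C 8⁻¹ * X 1 ^ 2), 2 * C 8⁻¹ * X 2,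
      -2 * C 8⁻¹ * X 1])
    (by
      ext1 i
      fin_cases i <;>
        simp only [Fin.zero_eta, Fin.mk_one, Fin.reduceFinMk, AlgHom.comp_apply, aeval_X,
          Matrix.cons_val, map_mul, map_neg, map_sub, map_pow, map_ofNat, algHom_C,
          algebraMap_eq, AlgHom.id_apply]
      · linear_combination -8 * C 8⁻¹ * X 0 * C_I_sq +
          (X 0 + 8 * C Complex.I * C 8⁻¹ * X 2 ^ 2) * eight_mul_C_inv_eight
      · linear_combination X 1 * eight_mul_C_inv_eight
      · linear_combination X 2 * eight_mul_C_inv_eight)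
    (by
      ext1 i
      fin_cases i <;>
        simp only [Fin.zero_eta, Fin.mk_one, Fin.reduceFinMk, AlgHom.comp_apply, aeval_X,
          Matrix.cons_val, map_mul, map_neg, map_add, map_pow, map_ofNat, algHom_C,
          algebraMap_eq, AlgHom.id_apply]
      · linear_combination -8 * C 8⁻¹ * (X 0 - 4 * C 8⁻¹ * X 1 ^ 2) * C_I_sq +
          X 0 * eight_mul_C_inv_eight
      · linear_combination X 1 * eight_mul_C_inv_eight
      · linear_combination X 2 * eight_mul_C_inv_eight)

theorem completeSquareEquiv_apply :
    completeSquareEquiv (X 0 ^ 2 - X 0 * X 1 ^ 2 + X 1 * X 2 ^ 2) =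
      C (-64) * (X 0 ^ 2 + X 1 ^ 2 * X 2 + X 2 ^ 4) := by
  rw [completeSquareEquiv, AlgEquiv.ofAlgHom_apply]
  simp only [map_add, map_sub, map_mul, map_pow, aeval_X, map_neg, map_ofNat, Matrix.cons_val]
  linear_combination 64 * X 0 ^ 2 * C_I_sq

/-- ℂ[x,y,z]/(x² − xy² + yz²) ≅ ℂ[x,y,z]/(x² + y²z + z⁴): the hypersurface
singularity obtained in the E₆ case is the D₅ Du Val singularity. -/
theorem stmt_15 :
    Nonempty
      ((MvPolynomial (Fin 3) ℂ ⧸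
          Ideal.span {(X 0 : MvPolynomial (Fin 3) ℂ) ^ 2 - X 0 * (X 1) ^ 2 +
            X 1 * (X 2) ^ 2}) ≃ₐ[ℂ]
        (MvPolynomial (Fin 3) ℂ ⧸
          Ideal.span {(X 0 : MvPolynomial (Fin 3) ℂ) ^ 2 + (X 1) ^ 2 * X 2 +
            (X 2) ^ 4})) := by
  refine ⟨Ideal.quotientEquivAlg _ _ completeSquareEquiv ?_⟩
  have hu : IsUnit (C (-64) : MvPolynomial (Fin 3) ℂ) :=
    (isUnit_iff_ne_zero.mpr (by norm_num)).map C
  rw [Ideal.map_span, Set.image_singleton]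
  change _ = Ideal.span {completeSquareEquiv _}
  rw [completeSquareEquiv_apply, Ideal.span_singleton_mul_left_unit hu]
end

section
/- Let a, b ∈ ℂ[y,z] with constant terms a₀ = a(0,0) ≠ 0 and b₀ = b(0,0) ≠ 0, and set a' = a(y²z³, yz²), b' = b(y²z³, yz²) ∈ ℂ[x,y,z]. Consider the system F₁ = a'·x·z + b' = 0, F₂ = x·(x+1) − y²·z = 0 in ℂ³. Then: (a) there is no solution with x = 0 and y = 0; (b) there is no solution with x = 0 and z = 0; (c) there is no solution with x = −1 and z = 0; (d) the solutions with x = −1 and y = 0 form exactly the single point (−1, 0, b₀/a₀). -/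
open MvPolynomial

/-- The substitution `(y, z) ↦ (y²z³, yz²)` turns a polynomial into one that is constant, equal to
its constant term, on the locus `yz = 0`. -/
theorem eval_aeval_eq_coeff_zero {R : Type*} [CommSemiring R] (q : MvPolynomial (Fin 2) R)
    (p : Fin 3 → R) (hp : p 1 * p 2 = 0) :
    eval p (aeval (![(X 1 : MvPolynomial (Fin 3) R) ^ 2 * (X 2) ^ 3, X 1 * (X 2) ^ 2]) q) =
      coeff 0 q := by
  have h₀ : p 1 ^ 2 * p 2 ^ 3 = 0 := by
    rw [show p 1 ^ 2 * p 2 ^ 3 = p 1 * p 2 * (p 1 * p 2 ^ 2) by ring, hp, zero_mul]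
  have h₁ : p 1 * p 2 ^ 2 = 0 := by
    rw [show p 1 * p 2 ^ 2 = p 1 * p 2 * p 2 by ring, hp, zero_mul]
  induction q using MvPolynomial.induction_on with
  | C r => simp [algebraMap_eq]
  | add f g hf hg => rw [map_add, map_add, coeff_add, hf, hg]
  | mul_X f i _ => fin_cases i <;> simp [h₀, h₁, coeff_mul_X']

/-- In chart (4) of the minimal resolution of the E₆ singularity, the strict
transform C̃ = V(a'xz + b', x(x+1) − y²z) (with a₀, b₀ ≠ 0) misses
E₁ = V(x,y), E₂ = V(x,z), E₄ = V(x+1,z) and meets E₅ = V(x+1,y) exactly at the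
single point (−1, 0, b₀/a₀). -/
theorem stmt_16 (a b : MvPolynomial (Fin 2) ℂ)
    (ha0 : MvPolynomial.coeff 0 a ≠ 0) (hb0 : MvPolynomial.coeff 0 b ≠ 0)
    (a' b' : MvPolynomial (Fin 3) ℂ)
    (ha' : a' = MvPolynomial.aeval
      (![(X 1 : MvPolynomial (Fin 3) ℂ) ^ 2 * (X 2) ^ 3, X 1 * (X 2) ^ 2]) a)
    (hb' : b' = MvPolynomial.aeval
      (![(X 1 : MvPolynomial (Fin 3) ℂ) ^ 2 * (X 2) ^ 3, X 1 * (X 2) ^ 2]) b)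
    (F₁ F₂ : MvPolynomial (Fin 3) ℂ)
    (hF₁ : F₁ = a' * X 0 * X 2 + b')
    (hF₂ : F₂ = X 0 * (X 0 + 1) - (X 1) ^ 2 * X 2) :
    (∀ x y z : ℂ, MvPolynomial.eval ![x, y, z] F₁ = 0 →
      MvPolynomial.eval ![x, y, z] F₂ = 0 → ¬(x = 0 ∧ y = 0)) ∧
    (∀ x y z : ℂ, MvPolynomial.eval ![x, y, z] F₁ = 0 →
      MvPolynomial.eval ![x, y, z] F₂ = 0 → ¬(x = 0 ∧ z = 0)) ∧
    (∀ x y z : ℂ, MvPolynomial.eval ![x, y, z] F₁ = 0 →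
      MvPolynomial.eval ![x, y, z] F₂ = 0 → ¬(x = -1 ∧ z = 0)) ∧
    {p : Fin 3 → ℂ | MvPolynomial.eval p F₁ = 0 ∧ MvPolynomial.eval p F₂ = 0 ∧
        p 0 = -1 ∧ p 1 = 0} =
      {![-1, 0, MvPolynomial.coeff 0 b / MvPolynomial.coeff 0 a]} := by
  subst ha' hb' hF₁ hF₂
  refine ⟨?_, ?_, ?_, ?_⟩
  iterate 3
    · rintro x y z h - ⟨rfl, rfl⟩
      simp only [map_add, map_mul, eval_X] at h
      rw [eval_aeval_eq_coeff_zero b _ (by simp)] at h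
      exact hb0 (by simpa using h)
  · ext p
    simp only [Set.mem_ofPred_eq, Set.mem_singleton_iff]
    constructor
    · rintro ⟨h, -, hx, hy⟩
      simp only [map_add, map_mul, eval_X] at h
      rw [eval_aeval_eq_coeff_zero a _ (by simp [hy]),
        eval_aeval_eq_coeff_zero b _ (by simp [hy]), hx] at h
      have hz : p 2 = coeff 0 b / coeff 0 a := by
        rw [eq_div_iff ha0]
        linear_combination -h
      ext i
      fin_cases i <;> simp [hx, hy, hz]
    · rintro rfl
      refine ⟨?_, by simp, by simp, by simp⟩
      simp only [map_add, map_mul, eval_X]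
      rw [eval_aeval_eq_coeff_zero a _ (by simp), eval_aeval_eq_coeff_zero b _ (by simp)]
      simp
      field_simp
      ring
end

section
/- Let a, b, c ∈ ℂ[y,z] with constant terms a₀, b₀, c₀, and suppose a₀ ≠ 0. Set a' = a(y²z³, yz²), b' = b(y²z³, yz²), c' = c(y²z³, yz²) ∈ ℂ[x,y,z]. Then the set of solutions (x,y,z) ∈ ℂ³ of the system G₁ = a'·y + b'·(x+1)·y·z + c'·(x+1) = 0, G₂ = a'·x + b'·y²·z² + c'·y·z = 0 satisfying x = 0 and z = 0 is exactly the single point (0, −c₀/a₀, 0). -/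
open MvPolynomial

/-- Substituting polynomials that vanish at `p` and evaluating at `p` leaves the constant term. -/
theorem MvPolynomial.eval_aeval_of_eval_eq_zero {σ τ R : Type*} [CommSemiring R]
    (p : τ → R) (f : σ → MvPolynomial τ R) (hf : ∀ i, eval p (f i) = 0) (q : MvPolynomial σ R) :
    eval p (aeval f q) = coeff 0 q := by
  have key : (eval p).comp (aeval f : MvPolynomial σ R →ₐ[R] MvPolynomial τ R).toRingHom =
      constantCoeff := by
    ext i <;> simp [hf]
  exact congrArg (fun φ : MvPolynomial σ R →+* R => φ q) key

/-- In chart (4) of the minimal resolution of the E₆ singularity, the strict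
transform C̃ = V(G₁, G₂) (case (ii), a₀ ≠ 0) meets E₂ = V(x,z) exactly at the
single point (0, −c₀/a₀, 0). -/
theorem stmt_17 (a b c : MvPolynomial (Fin 2) ℂ)
    (ha0 : MvPolynomial.coeff 0 a ≠ 0)
    (a' b' c' : MvPolynomial (Fin 3) ℂ)
    (ha' : a' = MvPolynomial.aeval
      (![(X 1 : MvPolynomial (Fin 3) ℂ) ^ 2 * (X 2) ^ 3, X 1 * (X 2) ^ 2]) a)
    (hb' : b' = MvPolynomial.aeval
      (![(X 1 : MvPolynomial (Fin 3) ℂ) ^ 2 * (X 2) ^ 3, X 1 * (X 2) ^ 2]) b)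
    (hc' : c' = MvPolynomial.aeval
      (![(X 1 : MvPolynomial (Fin 3) ℂ) ^ 2 * (X 2) ^ 3, X 1 * (X 2) ^ 2]) c)
    (G₁ G₂ : MvPolynomial (Fin 3) ℂ)
    (hG₁ : G₁ = a' * X 1 + b' * (X 0 + 1) * X 1 * X 2 + c' * (X 0 + 1))
    (hG₂ : G₂ = a' * X 0 + b' * (X 1) ^ 2 * (X 2) ^ 2 + c' * X 1 * X 2) :
    {p : Fin 3 → ℂ | MvPolynomial.eval p G₁ = 0 ∧ MvPolynomial.eval p G₂ = 0 ∧
        p 0 = 0 ∧ p 2 = 0} =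
      {![0, -(MvPolynomial.coeff 0 c) / MvPolynomial.coeff 0 a, 0]} := by
  have hconst (p : Fin 3 → ℂ) (hp : p 2 = 0) (q : MvPolynomial (Fin 2) ℂ) :
      eval p (aeval (![(X 1 : MvPolynomial (Fin 3) ℂ) ^ 2 * (X 2) ^ 3, X 1 * (X 2) ^ 2]) q) =
        coeff 0 q :=
    eval_aeval_of_eval_eq_zero p _ (fun i => by fin_cases i <;> simp [hp]) q
  subst ha' hb' hc' hG₁ hG₂
  ext p
  simp only [Set.mem_ofPred_eq, Set.mem_singleton_iff]
  constructor
  · rintro ⟨h₁, -, h0, h2⟩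
    simp only [map_add, map_mul, eval_X, map_one, hconst p h2, h0, h2] at h₁
    ext i
    fin_cases i
    · simpa using h0
    · change p 1 = -(coeff 0 c) / coeff 0 a
      rw [eq_div_iff ha0]
      linear_combination h₁
    · simpa using h2
  · intro h
    have h0 : p 0 = 0 := by simp [h]
    have h1 : p 1 = -(coeff 0 c) / coeff 0 a := by simp [h]
    have h2 : p 2 = 0 := by simp [h]
    refine ⟨?_, ?_, h0, h2⟩
    · simp only [map_add, map_mul, eval_X, map_one, hconst p h2, h0, h1, h2]
      field_simp
      ring
    · simp [h0, h2]
end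

section
/- Let a, b, c ∈ ℂ[y,z] with constant terms a₀, b₀, c₀, and set a' = a(y²z³, yz²), b' = b(y²z³, yz²), c' = c(y²z³, yz²) ∈ ℂ[x,y,z]. Then the set of t ∈ ℂ such that the point (0, 0, t) satisfies both equations H₁ = a' + b'·(x+1)·z + c'·(x+1)·z² = 0 and H₂ = x·(x+1) − y²·z = 0 is exactly the set of roots of the polynomial c₀·t² + b₀·t + a₀. -/
open MvPolynomial

/-- Substituting `(y²z³, yz²)` and evaluating at a point `(0, 0, t)` of `V(x, y)` leaves only the
constant term. -/
lemma eval_aeval_eq_coeff_zero_s18 (p : MvPolynomial (Fin 2) ℂ) (t : ℂ) :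
    MvPolynomial.eval ![0, 0, t] (MvPolynomial.aeval
      (![(X 1 : MvPolynomial (Fin 3) ℂ) ^ 2 * (X 2) ^ 3, X 1 * (X 2) ^ 2]) p) =
      MvPolynomial.coeff 0 p := by
  induction p using MvPolynomial.induction_on with
  | C r => simp [algebraMap_eq]
  | add p q hp hq => simp only [map_add, hp, hq, coeff_add]
  | mul_X p i hp =>
    fin_cases i <;> simp [coeff_mul_X']

/-- In chart (4) of the minimal resolution of the E₆ singularity, the strict
transform C̃ = V(H₁, H₂) (case (iii)) meets E₁ = V(x,y) exactly at the points
(0,0,t) where t is a root of c₀t² + b₀t + a₀. -/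
theorem stmt_18 (a b c : MvPolynomial (Fin 2) ℂ)
    (a' b' c' : MvPolynomial (Fin 3) ℂ)
    (ha' : a' = MvPolynomial.aeval
      (![(X 1 : MvPolynomial (Fin 3) ℂ) ^ 2 * (X 2) ^ 3, X 1 * (X 2) ^ 2]) a)
    (hb' : b' = MvPolynomial.aeval
      (![(X 1 : MvPolynomial (Fin 3) ℂ) ^ 2 * (X 2) ^ 3, X 1 * (X 2) ^ 2]) b)
    (hc' : c' = MvPolynomial.aeval
      (![(X 1 : MvPolynomial (Fin 3) ℂ) ^ 2 * (X 2) ^ 3, X 1 * (X 2) ^ 2]) c)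
    (H₁ H₂ : MvPolynomial (Fin 3) ℂ)
    (hH₁ : H₁ = a' + b' * (X 0 + 1) * X 2 + c' * (X 0 + 1) * (X 2) ^ 2)
    (hH₂ : H₂ = X 0 * (X 0 + 1) - (X 1) ^ 2 * X 2) :
    {t : ℂ | MvPolynomial.eval ![0, 0, t] H₁ = 0 ∧
        MvPolynomial.eval ![0, 0, t] H₂ = 0} =
      {t : ℂ | MvPolynomial.coeff 0 c * t ^ 2 + MvPolynomial.coeff 0 b * t +
        MvPolynomial.coeff 0 a = 0} := by
  subst ha' hb' hc' hH₁ hH₂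
  ext t
  simp only [Set.mem_ofPred_eq, map_add, map_sub, map_mul, map_pow, map_one,
    eval_aeval_eq_coeff_zero_s18, eval_X]
  simp only [Matrix.cons_val, zero_add, mul_one, zero_mul, ne_eq, OfNat.ofNat_ne_zero,
    not_false_eq_true, zero_pow, sub_zero, and_true]
  rw [show coeff 0 a + coeff 0 b * t + coeff 0 c * t ^ 2 =
    coeff 0 c * t ^ 2 + coeff 0 b * t + coeff 0 a by ring]
end
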